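/- Let the pairs (U₁,V₁) and (U₂,V₂) of bounded linear operators on H satisfy the symplectic relations and set (U₃,V₃) := (U₂U₁ + V₂V̄₁, U₂V₁ + V₂Ū₁). Then the operator U₂* + (U₁*)⁻¹ V₁ᵀ V₂* is invertible (it equals (U₁*)⁻¹ U₃*), and the following identity holds: V₁*(U₁*)⁻¹ + Ū₁⁻¹ V₂* (U₂* + (U₁*)⁻¹ V₁ᵀ V₂*)⁻¹ (U₁*)⁻¹ = V₃*(U₃*)⁻¹. -/

import Mathlib

open ContinuousLinearMap
open scoped InnerProductSpace

variable {H : Type*} [NormedAddCommGroup H] [InnerProductSpace ℂ H] [CompleteSpace H]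

/-- The complex conjugate `Ā := J ∘ A ∘ J` of a bounded operator with respect to the
conjugation `J`. -/
noncomputable def conjOp (J : H →L⋆[ℂ] H) (A : H →L[ℂ] H) : H →L[ℂ] H :=
  (J.comp A).comp J

/-- The transpose `Aᵀ := J ∘ A* ∘ J` of a bounded operator with respect to the
conjugation `J`. -/
noncomputable def transp (J : H →L⋆[ℂ] H) (A : H →L[ℂ] H) : H →L[ℂ] H :=
  conjOp J (adjoint A)

/-- The pair `(U, V)` satisfies the symplectic relations:
`U U* − V V* = 1`, `U Vᵀ = V Uᵀ`, `U* U − Vᵀ V̄ = 1`, `Uᵀ V̄ = V* U`. -/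
def SymplecticPair (J : H →L⋆[ℂ] H) (U V : H →L[ℂ] H) : Prop :=
  U ∘L adjoint U - V ∘L adjoint V = 1 ∧
  U ∘L transp J V = V ∘L transp J U ∧
  adjoint U ∘L U - transp J V ∘L conjOp J V = 1 ∧
  transp J U ∘L conjOp J V = adjoint V ∘L U

section Involution

variable {R : Type*} [Ring R] [StarRing R] {c : R →+* R}

/-- The relation `u uᴴ - v vᴴ = 1` is preserved by composition of Bogoliubov pairs. -/
lemma bogoliubov_comp_mul_star_sub (hc : ∀ x, c (c x) = x) (hs : ∀ x, star (c x) = c (star x))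
    {u v p q : R} (h₁ : u * star u - v * star v = 1) (h₂ : u * c (star v) = v * c (star u))
    (k₁ : p * star p - q * star q = 1) :
    (p * u + q * c v) * star (p * u + q * c v) - (p * v + q * c u) * star (p * v + q * c u)
      = 1 := by
  have h₃ := congrArg c h₁
  have h₄ := congrArg c h₂
  simp only [map_mul, map_sub, map_one, hc] at h₃ h₄
  simp only [star_add, star_mul, hs]
  calc _ = p * (u * star u - v * star v) * star p
        + p * (u * c (star v) - v * c (star u)) * star q
        + q * (c v * star u - c u * star v) * star p
        - q * (c u * c (star u) - c v * c (star v)) * star q := by noncomm_ring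
    _ = 1 := by simp [h₁, h₂, h₃, h₄, k₁]

/-- The relation `uᴴ u - vᵀ v̄ = 1` is preserved by composition of Bogoliubov pairs. -/
lemma bogoliubov_comp_star_mul_sub (hc : ∀ x, c (c x) = x) (hs : ∀ x, star (c x) = c (star x))
    {u v p q : R} (h₁ : star u * u - c (star v) * c v = 1)
    (k₁ : star p * p - c (star q) * c q = 1) (k₂ : c (star p) * c q = star q * p) :
    star (p * u + q * c v) * (p * u + q * c v)
      - c (star (p * v + q * c u)) * c (p * v + q * c u) = 1 := by
  have k₃ := congrArg c k₁
  have k₄ := congrArg c k₂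
  simp only [map_mul, map_sub, map_one, hc] at k₃ k₄
  simp only [star_add, star_mul, map_add, map_mul, hs, hc]
  calc _ = star u * (star p * p - c (star q) * c q) * u
        + star u * (star p * q - c (star q) * c p) * c v
        + c (star v) * (star q * p - c (star p) * c q) * u
        - c (star v) * (c (star p) * c p - star q * q) * c v := by noncomm_ring
    _ = 1 := by simp [k₁, k₂, k₃, k₄, h₁]

/-- For a Bogoliubov pair with `u` invertible, `vᴴ (uᴴ)⁻¹ vᵀ + ū⁻¹ = uᵀ`. -/
lemma star_mul_inverse_mul_add_inverse (hc : ∀ x, c (c x) = x)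
    {u v : R} (hu : IsUnit u) (h₁ : u * star u - v * star v = 1)
    (h₂ : u * c (star v) = v * c (star u)) :
    star v * Ring.inverse (star u) * c (star v) + Ring.inverse (c u) = c (star u) := by
  have h₃ := congrArg c h₁
  have h₄ := congrArg c h₂
  simp only [map_mul, map_sub, map_one, hc] at h₃ h₄
  refine (hu.map c).mul_left_cancel ?_
  rw [mul_add, Ring.mul_inverse_cancel _ (hu.map c), ← mul_assoc, ← mul_assoc, h₄,
    mul_assoc (c v), Ring.mul_inverse_cancel _ hu.star, mul_one, ← h₃]
  abel

/-- The composition identity for Bogoliubov pairs, with `u` and `u₃ = p u + q v̄` invertible. -/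
lemma bogoliubov_comp_identity (hc : ∀ x, c (c x) = x) (hs : ∀ x, star (c x) = c (star x))
    {u v p q : R} (hu : IsUnit u) (hw : IsUnit (p * u + q * c v))
    (h₁ : u * star u - v * star v = 1) (h₂ : u * c (star v) = v * c (star u)) :
    IsUnit (star p + Ring.inverse (star u) * c (star v) * star q) ∧
    star p + Ring.inverse (star u) * c (star v) * star q
      = Ring.inverse (star u) * star (p * u + q * c v) ∧
    star v * Ring.inverse (star u)
      + Ring.inverse (c u) * star q
        * (Ring.inverse (star p + Ring.inverse (star u) * c (star v) * star q)
          * Ring.inverse (star u))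
      = star (p * v + q * c u) * Ring.inverse (star (p * u + q * c v)) := by
  have hinv : IsUnit (Ring.inverse (star u)) := hu.star.ringInverse
  have key : star p + Ring.inverse (star u) * c (star v) * star q
      = Ring.inverse (star u) * star (p * u + q * c v) := by
    rw [star_add, star_mul, star_mul, mul_add, hs, Ring.inverse_mul_cancel_left _ _ hu.star,
      mul_assoc]
  refine ⟨key ▸ hinv.mul hw.star, key, ?_⟩
  have hcancel : Ring.inverse (Ring.inverse (star u) * star (p * u + q * c v))
      * Ring.inverse (star u) = Ring.inverse (star (p * u + q * c v)) := by
    refine (hinv.mul hw.star).mul_left_cancel ?_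
    rw [Ring.mul_inverse_cancel_left _ _ (hinv.mul hw.star), mul_assoc,
      Ring.mul_inverse_cancel _ hw.star, mul_one]
  rw [key, hcancel]
  refine hw.star.mul_right_cancel ?_
  rw [add_mul, Ring.inverse_mul_cancel_right _ _ hw.star, Ring.inverse_mul_cancel_right _ _ hw.star,
    mul_assoc, ← key, star_add, star_mul, star_mul, hs,
    ← star_mul_inverse_mul_add_inverse hc hu h₁ h₂]
  noncomm_ring

end Involution

/-- If both `u uᴴ` and `uᴴ u` dominate `1` in a C⋆-algebra, then `u` is invertible. -/
lemma isUnit_of_mul_star_sub_eq_one {A : Type*} [CStarAlgebra A] [PartialOrder A]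
    [StarOrderedRing A] {u v w : A} (h₁ : u * star u - v * star v = 1)
    (h₂ : star u * u - star w * w = 1) : IsUnit u := by
  have k₁ : IsUnit (u * star u) := CStarAlgebra.isUnit_of_le 1
    (by rw [← sub_nonneg, ← h₁, sub_sub_cancel]; exact mul_star_self_nonneg v)
  have k₂ : IsUnit (star u * u) := CStarAlgebra.isUnit_of_le 1
    (by rw [← sub_nonneg, ← h₂, sub_sub_cancel]; exact star_mul_self_nonneg w)
  obtain ⟨a, ha⟩ := k₁.exists_right_inv
  obtain ⟨b, hb⟩ := k₂.exists_left_inv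
  exact isUnit_iff_exists_and_exists.2
    ⟨⟨star u * a, by rw [← mul_assoc, ha]⟩, ⟨b * star u, by rw [mul_assoc, hb]⟩⟩

/-- A conjugation reverses the inner product. -/
lemma inner_conjugation {E : Type*} [NormedAddCommGroup E] [InnerProductSpace ℂ E]
    (J : E →L⋆[ℂ] E) (hJnorm : ∀ x, ‖J x‖ = ‖x‖) (x y : E) :
    ⟪J x, J y⟫_ℂ = ⟪y, x⟫_ℂ := by
  have hadd : ‖J x + J y‖ = ‖y + x‖ := by rw [← map_add, hJnorm, add_comm]
  have hsub : ‖J x - J y‖ = ‖y - x‖ := by rw [← map_sub, hJnorm, norm_sub_rev]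
  have hsubI : ‖J x - Complex.I • J y‖ = ‖y - Complex.I • x‖ := by
    calc _ = ‖J (Complex.I • (y - Complex.I • x))‖ := by
          simp [smul_smul, sub_eq_add_neg, add_comm]
      _ = _ := by rw [hJnorm, norm_smul, Complex.norm_I, one_mul]
  have haddI : ‖J x + Complex.I • J y‖ = ‖y + Complex.I • x‖ := by
    calc _ = ‖J (-Complex.I • (y + Complex.I • x))‖ := by
          simp [smul_add, smul_smul, add_comm]
      _ = _ := by rw [hJnorm, norm_smul, norm_neg, Complex.norm_I, one_mul]
  rw [inner_eq_sum_norm_sq_div_four, inner_eq_sum_norm_sq_div_four y x]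
  simp only [RCLike.I_to_complex, hadd, hsub, hsubI, haddI]

/-- Complex conjugation of operators, as a ring homomorphism. -/
noncomputable def conjOpHom (J : H →L⋆[ℂ] H) (hJinv : ∀ x, J (J x) = x) :
    (H →L[ℂ] H) →+* (H →L[ℂ] H) where
  toFun := conjOp J
  map_one' := by ext x; simp [conjOp, hJinv]
  map_mul' A B := by ext x; simp [conjOp, hJinv]
  map_zero' := by ext x; simp [conjOp]
  map_add' A B := by ext x; simp [conjOp]

lemma conjOp_conjOp {E : Type*} [NormedAddCommGroup E] [InnerProductSpace ℂ E]
    (J : E →L⋆[ℂ] E) (hJinv : ∀ x, J (J x) = x) (A : E →L[ℂ] E) :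
    conjOp J (conjOp J A) = A := by
  ext x; simp [conjOp, hJinv]

lemma adjoint_conjOp (J : H →L⋆[ℂ] H) (hJinv : ∀ x, J (J x) = x) (hJnorm : ∀ x, ‖J x‖ = ‖x‖)
    (A : H →L[ℂ] H) : adjoint (conjOp J A) = conjOp J (adjoint A) := by
  refine ((eq_adjoint_iff _ _).2 fun x y => ?_).symm
  calc ⟪J (adjoint A (J x)), y⟫_ℂ = ⟪J (adjoint A (J x)), J (J y)⟫_ℂ := by rw [hJinv]
    _ = ⟪J (J x), J (A (J y))⟫_ℂ := by
      rw [inner_conjugation J hJnorm, inner_conjugation J hJnorm, adjoint_inner_right]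
    _ = ⟪x, J (A (J y))⟫_ℂ := by rw [hJinv]

/-- With `(U₃,V₃) = (U₂U₁ + V₂V̄₁, U₂V₁ + V₂Ū₁)`, the operator
`U₂* + (U₁*)⁻¹ V₁ᵀ V₂*` is invertible (it equals `(U₁*)⁻¹ U₃*`), and
`V₁*(U₁*)⁻¹ + Ū₁⁻¹ V₂* (U₂* + (U₁*)⁻¹ V₁ᵀ V₂*)⁻¹ (U₁*)⁻¹ = V₃*(U₃*)⁻¹`. -/
theorem statement15 (J : H →L⋆[ℂ] H) (hJinv : ∀ x, J (J x) = x) (hJnorm : ∀ x, ‖J x‖ = ‖x‖)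
    (U₁ V₁ U₂ V₂ : H →L[ℂ] H)
    (h1 : SymplecticPair J U₁ V₁) (h2 : SymplecticPair J U₂ V₂) :
    IsUnit (adjoint U₂ + (Ring.inverse (adjoint U₁) ∘L transp J V₁) ∘L adjoint V₂) ∧
    adjoint U₂ + (Ring.inverse (adjoint U₁) ∘L transp J V₁) ∘L adjoint V₂
      = Ring.inverse (adjoint U₁) ∘L adjoint (U₂ ∘L U₁ + V₂ ∘L conjOp J V₁) ∧
    adjoint V₁ ∘L Ring.inverse (adjoint U₁)
      + (Ring.inverse (conjOp J U₁) ∘L adjoint V₂)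
        ∘L Ring.inverse (adjoint U₂ + (Ring.inverse (adjoint U₁) ∘L transp J V₁) ∘L adjoint V₂)
        ∘L Ring.inverse (adjoint U₁)
      = adjoint (U₂ ∘L V₁ + V₂ ∘L conjOp J U₁)
          ∘L Ring.inverse (adjoint (U₂ ∘L U₁ + V₂ ∘L conjOp J V₁)) := by
  obtain ⟨a₁, a₂, a₃, -⟩ := h1
  obtain ⟨b₁, -, b₃, b₄⟩ := h2
  have hc : ∀ A, conjOpHom J hJinv (conjOpHom J hJinv A) = A := conjOp_conjOp J hJinv
  have hs : ∀ A, star (conjOpHom J hJinv A) = conjOpHom J hJinv (star A) :=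
    adjoint_conjOp J hJinv hJnorm
  have hU₁ : IsUnit U₁ :=
    isUnit_of_mul_star_sub_eq_one a₁ (w := conjOpHom J hJinv V₁) (by rw [hs]; exact a₃)
  have hU₃ : IsUnit (U₂ * U₁ + V₂ * conjOpHom J hJinv V₁) :=
    isUnit_of_mul_star_sub_eq_one (bogoliubov_comp_mul_star_sub hc hs a₁ a₂ b₁)
      (w := conjOpHom J hJinv (U₂ * V₁ + V₂ * conjOpHom J hJinv U₁))
      (by rw [hs]; exact bogoliubov_comp_star_mul_sub hc hs a₃ b₃ b₄)
  exact bogoliubov_comp_identity hc hs hU₁ hU₃ a₁ a₂
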